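/- Let p be analytic on 𝔻 with p(0) = 1 and p(z) ≠ 0 for all z ∈ 𝔻. Let γ = log(e/(e − 1)) and let β ≥ (1/γ)·Σ_{n=1}^∞ (−1)^{n+1}/(n!·n) (≈ 1.736740) be a real number. If the function z ↦ 1 + β·z·p'(z)/p(z) is subordinate to e^z, then p(z) is subordinate to ℘(z) = 1 + z e^z. -/

import Mathlib

open Complex Metric

/-- `F` is subordinate to `G` on the unit disk `𝔻`. -/
def Subordinate (F G : ℂ → ℂ) : Prop :=
  ∃ ω : ℂ → ℂ, AnalyticOn ℂ ω (ball (0 : ℂ) 1) ∧ ω 0 = 0 ∧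
    (∀ z ∈ ball (0 : ℂ) 1, ω z ∈ ball (0 : ℂ) 1) ∧
    ∀ z ∈ ball (0 : ℂ) 1, F z = G (ω z)

lemma aux_exp_neg_le (s : ℝ) (hs : 0 ≤ s) : Real.exp (-s) ≤ 1 - s + s ^ 2 / 2 := by
  have h1 := Real.quadratic_le_exp_of_nonneg hs
  have h2 : Real.exp (-s) * Real.exp s = 1 := by rw [← Real.exp_add]; simp
  have h3 : 0 < Real.exp (-s) := Real.exp_pos _
  have h4 : 0 < 1 - s + s ^ 2 / 2 := by nlinarith [sq_nonneg (s - 1)]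
  by_contra h
  push Not at h
  have : (1 - s + s ^ 2 / 2) * (1 + s + s ^ 2 / 2) < Real.exp (-s) * Real.exp s :=
    mul_lt_mul h h1 (by positivity) h3.le
  nlinarith [sq_nonneg (s ^ 2)]

lemma aux_re_exp (ζ : ℂ) (t : ℝ) (h : ‖ζ‖ ≤ t) (ht : t ≤ 1) :
    Real.exp (-t) ≤ (Complex.exp ζ).re := by
  have h0 : Real.exp (-t) ≤ Real.exp (-‖ζ‖) := Real.exp_le_exp.2 (by linarith)
  refine h0.trans ?_
  have hx := Complex.abs_re_le_norm ζ
  have hn : ‖ζ‖ ^ 2 = ζ.re ^ 2 + ζ.im ^ 2 := by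
    rw [Complex.sq_norm, Complex.normSq_apply]; ring
  have hs : 0 ≤ ζ.re + ‖ζ‖ := by linarith [neg_abs_le ζ.re]
  have h1 := aux_exp_neg_le _ hs
  have h2 := Real.one_sub_sq_div_two_le_cos (x := ζ.im)
  rw [Complex.exp_re]
  have h3 : Real.exp (-‖ζ‖) = Real.exp ζ.re * Real.exp (-(ζ.re + ‖ζ‖)) := by
    rw [← Real.exp_add]; congr 1; ring
  rw [h3]
  refine mul_le_mul_of_nonneg_left ?_ (Real.exp_pos _).le
  nlinarith [mul_nonneg hs (sub_nonneg.2 (h.trans ht))]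

lemma aux_norm_exp_sub_one (ζ : ℂ) (t : ℝ) (h : ‖ζ‖ ≤ t) (ht : t ≤ 1) :
    ‖Complex.exp ζ - 1‖ ≤ t * (1 + t / 2 + t ^ 2 / 6 + t ^ 3 / 18) := by
  have h0 : 0 ≤ t := (norm_nonneg _).trans h
  have h1 : ‖Complex.exp ζ - 1‖ ≤ Real.exp ‖ζ‖ - 1 := by
    have := Complex.norm_exp_sub_sum_le_exp_norm_sub_sum ζ 1
    simpa using this
  have h2 : Real.exp ‖ζ‖ ≤ Real.exp t := Real.exp_le_exp.2 h
  have h3 := Real.exp_bound' h0 ht (n := 4) (by norm_num)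
  simp [Finset.sum_range_succ, Nat.factorial] at h3
  nlinarith [pow_nonneg h0 4]

lemma aux_inj (z w : ℂ) (hz : ‖z‖ < 1) (hw : ‖w‖ < 1)
    (h : z * Complex.exp z = w * Complex.exp w) : z = w := by
  by_cases hz0 : z = 0
  · subst hz0
    have : w = 0 := by simpa using h.symm
    exact this.symm
  by_cases hw0 : w = 0
  · subst hw0
    simp at h
    exact h
  have e1 : Complex.exp (Complex.log z + z) = Complex.exp (Complex.log w + w) := by
    rw [Complex.exp_add, Complex.exp_add, Complex.exp_log hz0, Complex.exp_log hw0, h]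
  obtain ⟨k, hk⟩ := Complex.exp_eq_exp_iff_exists_int.1 e1
  set s := Complex.log z with hs
  set u := Complex.log w + k * (2 * Real.pi * Complex.I) with hu
  have es : Complex.exp s = z := Complex.exp_log hz0
  have eu : Complex.exp u = w := by
    rw [hu, Complex.exp_add, Complex.exp_log hw0, Complex.exp_int_mul_two_pi_mul_I, mul_one]
  have key : s - u = Complex.exp u - Complex.exp s := by
    rw [es, eu, hu]; linear_combination hk
  set C := max ‖z‖ ‖w‖ with hC
  have hC1 : C < 1 := max_lt hz hw
  have hC0 : 0 < C := lt_of_lt_of_le (norm_pos_iff.2 hz0) (le_max_left _ _)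
  have hconv : Convex ℝ {x : ℂ | x.re ≤ Real.log C} := by
    have := convex_halfSpace_re_le (Real.log C)
    simpa using this
  have hle : ∀ x : ℂ, x.re ≤ Real.log C ↔ ‖Complex.exp x‖ ≤ C := by
    intro x
    rw [Complex.norm_exp, Real.le_log_iff_exp_le hC0]
  have hb := hconv.norm_image_sub_le_of_norm_deriv_le (f := Complex.exp) (C := C) (x := s) (y := u)
    (fun x _ => Complex.differentiable_exp x)
    (fun x hx => by rw [Complex.deriv_exp]; exact (hle x).1 hx)
    ((hle s).2 (by rw [es]; exact le_max_left _ _))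
    ((hle u).2 (by rw [eu]; exact le_max_right _ _))
  rw [← key, norm_sub_rev u s] at hb
  have : ‖s - u‖ = 0 := by
    by_contra hne
    have : 0 < ‖s - u‖ := lt_of_le_of_ne (norm_nonneg _) (Ne.symm hne)
    nlinarith
  have : s = u := by rwa [norm_eq_zero, sub_eq_zero] at this
  rw [← es, ← eu, this]

/-- the boundary lemma, in real form -/
lemma aux_boundary (φ : ℝ) (h0 : 0 ≤ φ) (hπ : φ ≤ Real.pi) (r δ : ℝ)
    (hr : r = Real.exp (-Real.cos φ)) (hδ : δ = φ - Real.sin φ) :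
    (1 - r * Real.cos δ) ^ 2 + (r * Real.sin δ) ^ 2 ≤ (1 - Real.exp (-1)) ^ 2 ∨
    1 - r * Real.cos δ ≤ |r * Real.sin δ| ∨ 1.19 ≤ r := by
  have hrp : 0 < r := hr ▸ Real.exp_pos _
  have hδ0 : 0 ≤ δ := by rw [hδ]; linarith [Real.sin_le h0]
  have hδ1 : δ ≤ φ ^ 3 / 6 := by
    rcases h0.eq_or_lt with h | h
    · subst h; simp [hδ]
    · rw [hδ]; linarith [Real.sin_gt_sub_cube h]
  rcases le_total φ 1.5 with h1 | h1
  · left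
    have hc : 0 ≤ Real.cos φ := Real.cos_nonneg_of_neg_pi_div_two_le_of_le
      (by linarith [Real.pi_gt_three]) (by linarith [Real.pi_gt_three])
    have hr1 : r ≤ 1 := by rw [hr]; exact Real.exp_le_one_iff.2 (by linarith)
    set e := Real.exp (-1) with he
    have he1 : e < 0.3679 := by linarith [Real.exp_neg_one_lt_d9]
    have he0 : 0 < e := Real.exp_pos _
    have hcos := Real.one_sub_sq_div_two_le_cos (x := δ)
    have hsc := Real.sin_sq_add_cos_sq δ
    set k := 1 - Real.cos φ with hk
    have hk0 : 0 ≤ k := by linarith [Real.cos_le_one φ]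
    have hk2 : φ ^ 2 * 0.4 ≤ k := by
      have hs := Real.sin_gt_sub_cube (x := φ / 2)
      have hs2 : k = 2 * Real.sin (φ / 2) ^ 2 := by
        have := Real.cos_sq' (φ / 2)
        have h2 := Real.cos_two_mul (φ / 2)
        rw [show 2 * (φ / 2) = φ by ring] at h2
        rw [hk, h2, this]; ring
      rcases h0.eq_or_lt with h | h
      · subst h; simp [hk]
      have hs := hs (by positivity)
      have h4 : (φ / 2) * (1 - 0.5625 / 6) ≤ Real.sin (φ / 2) := by
        have : φ ^ 2 ≤ 2.25 := by nlinarith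
        nlinarith
      have h5 : ((φ / 2) * (1 - 0.5625 / 6)) ^ 2 ≤ Real.sin (φ / 2) ^ 2 :=
        pow_le_pow_left₀ (by norm_num; positivity) h4 2
      rw [hs2]; nlinarith [sq_nonneg φ]
    -- e ≤ r (1 - (1-e) k)
    have hek : e ≤ r * (1 - k * (1 - e)) := by
      have h6 : e = r * Real.exp (-k) := by
        rw [hr, he, ← Real.exp_add]; congr 1; rw [hk]; ring
      have h7 : Real.exp (-k) ≤ 1 - k * (1 - e) := by
        have hk1 : 0 ≤ 1 - k := by rw [hk]; linarith
        have := convexOn_exp.2 (Set.mem_univ (0:ℝ)) (Set.mem_univ (-1:ℝ)) hk1 hk0 (by ring)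
        simp at this
        rw [← he] at this
        linarith
      calc e = r * Real.exp (-k) := h6
        _ ≤ _ := mul_le_mul_of_nonneg_left h7 hrp.le
    have hd2 : δ ^ 2 ≤ k * 0.3995 := by
      have : δ ^ 2 ≤ (φ ^ 3 / 6) ^ 2 := pow_le_pow_left₀ hδ0 hδ1 2
      have h8 : φ ^ 4 ≤ 1.5 ^ 4 := pow_le_pow_left₀ h0 h1 4
      have h9 : (φ ^ 3 / 6) ^ 2 = φ ^ 2 * (φ ^ 4 / 36) := by ring
      have h10 : φ ^ 2 * (φ ^ 4 / 36) ≤ φ ^ 2 * (0.4 * 0.3995) := by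
        apply mul_le_mul_of_nonneg_left _ (sq_nonneg φ)
        norm_num at h8 ⊢; linarith
      linarith
    have h11 : k * 0.3995 ≤ k * (1 - e) * (1 - e) := by
      have : 0.3995 ≤ (1 - e) * (1 - e) := by nlinarith
      nlinarith
    have h12 : r * (k * (1 - e)) ≤ r - e := by linarith
    have h13 : r * (k * (1 - e)) * (1 - e) ≤ (r - e) * (2 - r - e) :=
      mul_le_mul h12 (by linarith) (by linarith) (by
        have : 0 ≤ r * (k * (1 - e)) := by
          have : 0 ≤ 1 - e := by linarith
          positivity
        linarith)
    have h14 : r * δ ^ 2 ≤ r * (k * (1 - e) * (1 - e)) :=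
      mul_le_mul_of_nonneg_left (by linarith) hrp.le
    have h15 : r * (2 * (1 - Real.cos δ)) ≤ r * δ ^ 2 :=
      mul_le_mul_of_nonneg_left (by linarith) hrp.le
    have h16 : (1 - r * Real.cos δ) ^ 2 + (r * Real.sin δ) ^ 2
        = (1 - r) ^ 2 + r * (2 * (1 - Real.cos δ)) := by
      linear_combination r ^ 2 * hsc
    rw [h16]
    nlinarith
  rcases le_total φ 1.75 with h2 | h2
  · right; left
    refine le_trans ?_ (le_abs_self _)
    have hp := Real.pi_gt_d2
    have hp' := Real.pi_lt_d2
    have hr1 : 0.92 ≤ r := by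
      have : Real.cos φ ≤ 0.08 := by
        rw [← Real.sin_pi_div_two_sub]
        rcases le_total (Real.pi / 2 - φ) 0 with h | h
        · have := Real.sin_nonpos_of_nonpos_of_neg_pi_le h (by linarith)
          linarith
        · have := Real.sin_le h
          linarith
      have h3 := Real.add_one_le_exp (-Real.cos φ)
      rw [hr]; linarith
    have hsl : 0.95 ≤ Real.sin φ := by
      rw [← Real.cos_pi_div_two_sub]
      have := Real.one_sub_sq_div_two_le_cos (x := Real.pi / 2 - φ)
      nlinarith
    have d1 : 0.5 ≤ δ := by rw [hδ]; linarith [Real.sin_le_one φ]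
    have d2 : δ ≤ 0.8 := by rw [hδ]; linarith
    have c1 := Real.one_sub_sq_div_two_le_cos (x := δ)
    have c2 := Real.sin_gt_sub_cube (x := δ) (by linarith)
    have c3 : 1.1 ≤ Real.cos δ + Real.sin δ := by
      have : 1.1 ≤ (1 - δ ^ 2 / 2) + (δ - δ ^ 3 / 6) := by
        nlinarith [mul_nonneg (sub_nonneg.2 d1) (sub_nonneg.2 d2), mul_nonneg (mul_nonneg (sub_nonneg.2 d1) (sub_nonneg.2 d2)) hδ0]
      linarith
    nlinarith
  · right; right
    have hp := Real.pi_gt_d2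
    have hp' := Real.pi_lt_d4
    have h3 : Real.cos φ ≤ Real.cos 1.75 :=
      Real.cos_le_cos_of_nonneg_of_le_pi (by norm_num) hπ h2
    have h4 : Real.cos 1.75 ≤ -0.175 := by
      have h5 : Real.cos 1.75 = - Real.sin (1.75 - Real.pi / 2) := by
        rw [← Real.cos_pi_div_two_sub, ← Real.cos_pi_sub]; congr 1; ring
      have h6 := Real.sin_gt_sub_cube (x := 1.75 - Real.pi / 2) (by linarith)
      rw [h5]
      have h7 : (1.75 - Real.pi / 2) ^ 3 ≤ 0.18 ^ 3 :=
        pow_le_pow_left₀ (by linarith) (by linarith) 3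
      norm_num at h7 h6 ⊢
      linarith
    have h5 : Real.exp 0.175 ≤ r := by rw [hr]; exact Real.exp_le_exp.2 (by linarith)
    have h6 := Real.quadratic_le_exp_of_nonneg (x := 0.175) (by norm_num)
    norm_num at h6 h5 ⊢; linarith

/-- The series `S(t) = ∑ (-1)^n t^(n+1)/((n+1)! (n+1))`. -/
noncomputable def auxS (t : ℝ) : ℝ :=
  ∑' n : ℕ, (-1 : ℝ) ^ (n + 2) / ((Nat.factorial (n + 1) : ℝ) * ((n : ℝ) + 1)) * t ^ (n + 1)

noncomputable def auxS' (t : ℝ) : ℝ :=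
  ∑' n : ℕ, (-1 : ℝ) ^ (n + 2) / (Nat.factorial (n + 1) : ℝ) * t ^ n

lemma auxS'_mul (t : ℝ) : t * auxS' t = 1 - Real.exp (-t) := by
  have h1 : HasSum (fun n : ℕ => (-t) ^ n / (Nat.factorial n : ℝ)) (Real.exp (-t)) := by
    rw [Real.exp_eq_exp_ℝ]
    exact NormedSpace.expSeries_div_hasSum_exp (-t)
  have h2 := (hasSum_nat_add_iff' 1).2 h1
  simp only [Finset.sum_range_one, pow_zero, Nat.factorial_zero, Nat.cast_one, div_one] at h2
  have h3 := h2.neg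
  rw [auxS', ← tsum_mul_left, show 1 - Real.exp (-t) = -(Real.exp (-t) - 1) by ring, ← h3.tsum_eq]
  congr 1
  ext n
  rw [neg_pow t]
  ring

lemma auxS_hasDeriv (t : ℝ) (ht : |t| < 2) : HasDerivAt auxS (auxS' t) t := by
  have hb : Summable (fun n : ℕ => (2 : ℝ) ^ n / (Nat.factorial n : ℝ)) :=
    Real.summable_pow_div_factorial 2
  refine hasDerivAt_tsum_of_isPreconnected (t := ball (0:ℝ) 2) hb isOpen_ball
    (convex_ball (0:ℝ) 2).isPreconnected
    (g' := fun n t => (-1 : ℝ) ^ (n + 2) / (Nat.factorial (n + 1) : ℝ) * t ^ n)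
    ?_ ?_ (y₀ := 0) (by simp) ?_ (by simpa using ht)
  · intro n y _
    have := (hasDerivAt_pow (n + 1) y).const_mul
      ((-1 : ℝ) ^ (n + 2) / ((Nat.factorial (n + 1) : ℝ) * ((n : ℝ) + 1)))
    convert! this using 1
    have : (n : ℝ) + 1 ≠ 0 := by positivity
    have : (Nat.factorial (n + 1) : ℝ) ≠ 0 := by positivity
    simp
    field_simp
  · intro n y hy
    have hy : |y| ≤ 2 := by simpa using (mem_ball_zero_iff.1 hy).le
    simp only [norm_mul, norm_div, norm_pow, norm_neg, norm_one, one_pow, Real.norm_eq_abs,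
      Nat.abs_cast]
    have h1 : |y| ^ n ≤ 2 ^ n := pow_le_pow_left₀ (abs_nonneg _) hy n
    have h2 : (Nat.factorial n : ℝ) ≤ Nat.factorial (n + 1) := by
      exact_mod_cast Nat.factorial_le (Nat.le_succ n)
    have h3 : (0 : ℝ) < Nat.factorial n := by positivity
    rw [div_mul_eq_mul_div, one_mul]
    gcongr
  · simp [summable_zero]

lemma auxS_strictMono : StrictMonoOn auxS (Set.Icc 0 1) := by
  have hd : ∀ t ∈ Set.Icc (0:ℝ) 1, HasDerivAt auxS (auxS' t) t := fun t ht =>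
    auxS_hasDeriv t (by rw [abs_of_nonneg ht.1]; linarith [ht.2])
  refine strictMonoOn_of_deriv_pos (convex_Icc 0 1)
    (fun t ht => (hd t ht).continuousAt.continuousWithinAt) ?_
  intro t ht
  rw [interior_Icc] at ht
  rw [(hd t ⟨ht.1.le, ht.2.le⟩).deriv]
  have h1 := auxS'_mul t
  have h2 : Real.exp (-t) < 1 := Real.exp_lt_one_iff.2 (by linarith [ht.1])
  have h3 : 0 < t * auxS' t := by linarith
  exact pos_of_mul_pos_right h3 ht.1.le

lemma auxS_zero : auxS 0 = 0 := by simp [auxS]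

/-- lower bound for the constant -/
lemma auxS_one : 0.79 ≤ auxS 1 := by
  have hd : ∀ t ∈ Set.Icc (0:ℝ) 1, HasDerivAt (fun t => auxS t - (t - t ^ 2 / 4 + t ^ 3 / 18 - t ^ 4 / 72))
      (auxS' t - (1 - t / 2 + t ^ 2 / 6 - t ^ 3 / 18)) t := fun t ht => by
    have h1 := auxS_hasDeriv t (by rw [abs_of_nonneg ht.1]; linarith [ht.2])
    have h2 := (((hasDerivAt_id t).sub ((hasDerivAt_pow 2 t).div_const 4)).add
      ((hasDerivAt_pow 3 t).div_const 18)).sub ((hasDerivAt_pow 4 t).div_const 72)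
    convert! h1.sub h2 using 1
    norm_num; ring
  have hm : MonotoneOn (fun t => auxS t - (t - t ^ 2 / 4 + t ^ 3 / 18 - t ^ 4 / 72)) (Set.Icc 0 1) := by
    refine monotoneOn_of_deriv_nonneg (convex_Icc 0 1)
      (fun t ht => (hd t ht).continuousAt.continuousWithinAt) 
      (fun t ht => (hd t (interior_subset ht)).differentiableAt.differentiableWithinAt) ?_
    intro t ht
    rw [(hd t (interior_subset ht)).deriv]
    rw [interior_Icc] at ht
    have h1 := auxS'_mul t
    have h3 : Real.exp (-t) ≤ 1 - t + t ^ 2 / 2 - t ^ 3 / 6 + t ^ 4 / 18 := by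
      have := Real.exp_bound (x := -t) (by rw [abs_neg, abs_of_pos ht.1]; exact ht.2.le) (n := 4) (by norm_num)
      have := (abs_le.1 this).2
      rw [abs_neg, abs_of_pos ht.1] at this
      simp [Finset.sum_range_succ, Nat.factorial] at this
      nlinarith [pow_pos ht.1 4]
    have h4 : 0 ≤ t * (auxS' t - (1 - t / 2 + t ^ 2 / 6 - t ^ 3 / 18)) := by
      rw [mul_sub, h1]; nlinarith
    exact nonneg_of_mul_nonneg_right h4 ht.1
  have := hm (Set.left_mem_Icc.2 zero_le_one) (Set.right_mem_Icc.2 zero_le_one) zero_le_one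
  simp only [auxS_zero] at this
  norm_num at this ⊢
  linarith

lemma aux_gamma (γ : ℝ) (hγ : γ = Real.log (Real.exp 1 / (Real.exp 1 - 1))) :
    0 < γ ∧ γ ≤ 0.464 ∧ Real.exp (-γ) = 1 - Real.exp (-1) := by
  have h1 := Real.exp_one_gt_d9
  have h2 := Real.exp_one_lt_d9
  have h3 : 0 < Real.exp 1 - 1 := by linarith
  refine ⟨?_, ?_, ?_⟩
  · rw [hγ]; apply Real.log_pos
    rw [one_lt_div h3]; linarith
  · rw [hγ, Real.log_le_iff_le_exp (by positivity)]
    have := Real.sum_le_exp_of_nonneg (x := 0.464) (by norm_num) 5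
    simp [Finset.sum_range_succ, Nat.factorial] at this
    refine le_trans ?_ this
    rw [div_le_iff₀ h3]
    norm_num
    linarith
  · rw [hγ, Real.exp_neg, Real.exp_log (by positivity), Real.exp_neg]
    field_simp

lemma aux_unit (ζ : ℂ) (hζ : ‖ζ‖ = 1) (w : ℂ) (hw : w = 1 + ζ * Complex.exp ζ) :
    ‖w‖ ≤ 1 - Real.exp (-1) ∨ w.re ≤ |w.im| ∨ 1.19 ≤ ‖w - 1‖ := by
  obtain ⟨φ, h1, h2, hφ⟩ : ∃ φ : ℝ, -Real.pi ≤ φ ∧ φ ≤ Real.pi ∧ ζ = -Complex.exp (-(φ * I)) := by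
    refine ⟨-(-ζ).arg, by linarith [Complex.arg_le_pi (-ζ)],
      by linarith [Complex.neg_pi_lt_arg (-ζ)], ?_⟩
    have := Complex.norm_mul_exp_arg_mul_I (-ζ)
    rw [norm_neg, hζ] at this
    push_cast
    simp at this
    simp [this]
  have hre : ζ.re = -Real.cos φ := by
    rw [hφ, Complex.neg_re, Complex.exp_re]; simp
  have him : ζ.im = Real.sin φ := by
    rw [hφ, Complex.neg_im, Complex.exp_im]; simp
  set r := Real.exp (-Real.cos φ) with hr
  set δ := φ - Real.sin φ with hδ
  have hwe : ζ * Complex.exp ζ = -(r * Complex.exp (-(δ * I))) := by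
    have h3 : Complex.exp ζ = r * Complex.exp (Real.sin φ * I) := by
      conv_lhs => rw [← Complex.re_add_im ζ, hre, him, Complex.exp_add]
      rw [hr, Complex.ofReal_exp]
    rw [h3]
    conv_lhs => rw [hφ]
    rw [show -(δ * I : ℂ) = -(φ * I) + Real.sin φ * I by rw [hδ]; push_cast; ring, Complex.exp_add]
    ring
  have hwr : w.re = 1 - r * Real.cos δ := by
    rw [hw, hwe]; simp [Complex.exp_re]; ring
  have hwi : w.im = r * Real.sin δ := by
    rw [hw, hwe]; simp [Complex.exp_im]
  have hwn : ‖w - 1‖ = r := by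
    rw [hw, hwe, add_sub_cancel_left, norm_neg, norm_mul, Complex.norm_real, Real.norm_eq_abs,
      abs_of_pos (Real.exp_pos _), Complex.norm_exp]
    simp [hr]
  have hn2 : ‖w‖ ^ 2 = (1 - r * Real.cos δ) ^ 2 + (r * Real.sin δ) ^ 2 := by
    rw [Complex.sq_norm, Complex.normSq_apply, hwr, hwi]; ring
  have key : (1 - r * Real.cos δ) ^ 2 + (r * Real.sin δ) ^ 2 ≤ (1 - Real.exp (-1)) ^ 2 ∨
      1 - r * Real.cos δ ≤ |r * Real.sin δ| ∨ 1.19 ≤ r := by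
    rcases le_total 0 φ with h | h
    · exact aux_boundary φ h h2 r δ rfl rfl
    · have := aux_boundary (-φ) (by linarith) (by linarith) r (-δ) (by rw [Real.cos_neg])
        (by rw [Real.sin_neg, hδ]; ring)
      simpa using this
  rcases key with h | h | h
  · left
    rw [← hn2] at h
    refine le_of_sq_le_sq h ?_
    have : Real.exp (-1) ≤ 1 := Real.exp_le_one_iff.2 (by norm_num)
    linarith
  · right; left; rw [hwr, hwi]; exact h
  · right; right; rw [hwn]; exact h

lemma aux_strict (ζ : ℂ) : HasStrictDerivAt (fun z : ℂ => 1 + z * Complex.exp z)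
    ((1 + ζ) * Complex.exp ζ) ζ := by
  have := ((hasStrictDerivAt_id ζ).mul (Complex.hasStrictDerivAt_exp ζ)).const_add 1
  convert! this using 1
  simp; ring

lemma aux_deriv_ne (ζ : ℂ) (h : ‖ζ‖ < 1) : (1 + ζ) * Complex.exp ζ ≠ 0 := by
  refine mul_ne_zero ?_ (Complex.exp_ne_zero _)
  intro h0
  have : ζ = -1 := by linear_combination h0
  rw [this] at h; simp at h

/-- If `p` avoids the image of the unit circle, then `p ≺ 1 + z e^z`. -/
lemma aux_subord (p : ℂ → ℂ) (hp : DifferentiableOn ℂ p (ball (0 : ℂ) 1)) (hp0 : p 0 = 1)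
    (hav : ∀ z ∈ ball (0 : ℂ) 1, ∀ ζ : ℂ, ‖ζ‖ = 1 → p z ≠ 1 + ζ * Complex.exp ζ) :
    Subordinate p (fun z => 1 + z * Complex.exp z) := by
  set P : ℂ → ℂ := fun z => 1 + z * Complex.exp z with hP
  have hPc : Continuous P := by rw [hP]; fun_prop
  have hPo : IsOpen (P '' ball 0 1) := by
    rw [isOpen_iff_mem_nhds]
    rintro _ ⟨ζ, hζ, rfl⟩
    rw [← (aux_strict ζ).map_nhds_eq (aux_deriv_ne ζ (by simpa using hζ))]
    exact Filter.image_mem_map (isOpen_ball.mem_nhds hζ)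
  have hPk : IsClosed (P '' closedBall 0 1) :=
    ((isCompact_closedBall (0:ℂ) 1).image hPc).isClosed
  have hU := hp.continuousOn.isOpen_inter_preimage isOpen_ball hPo
  have hV := hp.continuousOn.isOpen_inter_preimage isOpen_ball hPk.isOpen_compl
  have hsub : ball (0:ℂ) 1 ⊆ ball 0 1 ∩ p ⁻¹' (P '' ball 0 1) := by
    refine (convex_ball (0:ℂ) 1).isPreconnected.subset_left_of_subset_union hU hV ?_ ?_ ?_
    · rw [Set.disjoint_left]
      rintro z ⟨_, hz⟩ ⟨_, hz'⟩
      exact hz' (Set.image_mono ball_subset_closedBall hz)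
    · intro z hz
      by_cases h : p z ∈ P '' closedBall 0 1
      · left
        refine ⟨hz, ?_⟩
        obtain ⟨ζ, hζ, h⟩ := h
        refine ⟨ζ, ?_, h⟩
        rw [mem_closedBall_zero_iff] at hζ
        rw [mem_ball_zero_iff]
        refine lt_of_le_of_ne hζ fun h1 => hav z hz ζ h1 h.symm
      · right; exact ⟨hz, h⟩
    · exact ⟨0, by simp, by simp, 0, by simp, by simp [hP, hp0]⟩
  have hex : ∀ z ∈ ball (0:ℂ) 1, ∃ ζ ∈ ball (0:ℂ) 1, P ζ = p z := fun z hz => (hsub hz).2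
  choose! ω hω1 hω2 using hex
  have hinj : ∀ a ∈ ball (0:ℂ) 1, ∀ b ∈ ball (0:ℂ) 1, P a = P b → a = b := by
    intro a ha b hb h
    exact aux_inj a b (by simpa using ha) (by simpa using hb) (by simpa [hP] using h)
  refine ⟨ω, ?_, ?_, hω1, fun z hz => (hω2 z hz).symm⟩
  · rw [Complex.analyticOn_iff_differentiableOn isOpen_ball]
    intro z hz
    have hs := aux_strict (ω z)
    have hne := aux_deriv_ne (ω z) (by simpa using hω1 z hz)
    set g := hs.localInverse _ _ _ hne with hg
    have hpz : P (ω z) = p z := hω2 z hz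
    have hgd : DifferentiableAt ℂ g (p z) := by
      rw [← hpz]; exact (hs.to_localInverse hne).hasDerivAt.differentiableAt
    have hgr : ∀ᶠ x in nhds (p z), P (g x) = x := by
      rw [← hpz]; exact hs.eventually_right_inverse hne
    have hgv : g (p z) = ω z := by
      rw [← hpz]; exact (hs.eventually_left_inverse hne).self_of_nhds
    have hpd : DifferentiableAt ℂ p z := hp.differentiableAt (isOpen_ball.mem_nhds hz)
    have hgp : DifferentiableAt ℂ (fun y => g (p y)) z := hgd.comp z hpd
    have hev : ω =ᶠ[nhds z] fun y => g (p y) := by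
      have e1 := hpd.continuousAt.eventually hgr
      have e2 : ∀ᶠ y in nhds z, g (p y) ∈ ball (0:ℂ) 1 :=
        hgp.continuousAt.eventually (isOpen_ball.mem_nhds (by simpa only [hgv] using hω1 z hz))
      filter_upwards [e1, e2, isOpen_ball.mem_nhds hz] with y h1 h2 h3
      exact hinj _ (hω1 y h3) _ h2 (by rw [hω2 y h3, h1])
    exact (hgp.congr_of_eventuallyEq hev).differentiableWithinAt
  · exact hinj _ (hω1 0 (by simp)) 0 (by simp) (by rw [hω2 0 (by simp), hp0]; simp [hP])

theorem stmt_18 (p : ℂ → ℂ) (hp : AnalyticOn ℂ p (ball (0 : ℂ) 1)) (hp0 : p 0 = 1)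
    (hpne : ∀ z ∈ ball (0 : ℂ) 1, p z ≠ 0)
    (γ : ℝ) (hγ : γ = Real.log (Real.exp 1 / (Real.exp 1 - 1)))
    (β : ℝ)
    (hβ : (1 / γ) *
      (∑' n : ℕ, (-1 : ℝ) ^ (n + 2) / ((Nat.factorial (n + 1) : ℝ) * ((n : ℝ) + 1))) ≤ β)
    (hsub : Subordinate (fun z => 1 + (β : ℂ) * z * deriv p z / p z)
      (fun z => Complex.exp z)) :
    Subordinate p (fun z => 1 + z * Complex.exp z) := by
  obtain ⟨hγ0, hγ1, hγe⟩ := aux_gamma γ hγ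
  have hS1 : auxS 1 ≤ β * γ := by
    have h1 : auxS 1 = ∑' n : ℕ,
        (-1 : ℝ) ^ (n + 2) / ((Nat.factorial (n + 1) : ℝ) * ((n : ℝ) + 1)) := by simp [auxS]
    rw [← h1, div_mul_eq_mul_div, one_mul, div_le_iff₀ hγ0] at hβ
    exact hβ
  have hβ1 : 1.7 ≤ β := by
    have := auxS_one
    by_contra h
    push Not at h
    nlinarith
  have hβ0 : 0 < β := by linarith
  have hβC : (β : ℂ) ≠ 0 := by exact_mod_cast hβ0.ne'
  have hpd : DifferentiableOn ℂ p (ball 0 1) := hp.differentiableOn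
  obtain ⟨ω, hωa, hω0, hωm, hω⟩ := hsub
  have hωn : ∀ z : ℂ, ‖z‖ < 1 → ‖ω z‖ ≤ ‖z‖ := by
    intro z hz
    exact Complex.norm_le_norm_of_mapsTo_ball hωa.differentiableOn
      (fun z hz => ball_subset_closedBall (hωm z hz)) hω0 hz
  -- logarithm of p
  have hlog : DifferentiableOn ℂ (fun z => deriv p z / p z) (ball 0 1) :=
    (hpd.deriv isOpen_ball).div hpd hpne
  obtain ⟨f, hf0, hf⟩ := hlog.isExactOn_ball.with_val_at 0 0
  have hpf : ∀ z ∈ ball (0:ℂ) 1, p z = Complex.exp (f z) := by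
    have hd : ∀ z ∈ ball (0:ℂ) 1, HasDerivAt (fun z => p z * Complex.exp (-f z)) 0 z := by
      intro z hz
      have h1 := (hpd.differentiableAt (isOpen_ball.mem_nhds hz)).hasDerivAt
      have h2 := h1.mul ((hf z hz).neg.cexp)
      convert! h2 using 1
      have := hpne z hz
      simp
      field_simp
      ring
    intro z hz
    have h3 := (convex_ball (0:ℂ) 1).norm_image_sub_le_of_norm_hasDerivWithin_le (C := 0)
      (fun x hx => (hd x hx).hasDerivWithinAt) (by simp) (mem_ball_self one_pos) hz
    simp [hf0, hp0, sub_eq_zero] at h3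
    rw [Complex.exp_neg] at h3
    have := Complex.exp_ne_zero (f z)
    field_simp at h3
    exact h3
  have hray : ∀ z ∈ ball (0:ℂ) 1, ∀ t ∈ Set.Icc (0:ℝ) 1, (t * z : ℂ) ∈ ball (0:ℂ) 1 := by
    intro z hz t ht
    rw [mem_ball_zero_iff] at hz ⊢
    rw [norm_mul, Complex.norm_real, Real.norm_eq_abs, abs_of_nonneg ht.1]
    nlinarith [norm_nonneg z, ht.2]
  have hrd : ∀ z ∈ ball (0:ℂ) 1, ∀ t ∈ Set.Icc (0:ℝ) 1,
      HasDerivAt (fun t : ℝ => f (t * z)) (deriv p (t * z) / p (t * z) * z) t := by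
    intro z hz t ht
    have h1 : HasDerivAt (fun t : ℂ => t * z) z (t : ℂ) := by
      simpa using (hasDerivAt_id (t : ℂ)).mul_const z
    exact ((hf _ (hray z hz t ht)).comp (t : ℂ) h1).comp_ofReal
  have hode : ∀ z ∈ ball (0:ℂ) 1, ∀ t ∈ Set.Icc (0:ℝ) 1,
      (t : ℂ) * (deriv p (t * z) / p (t * z) * z) = (Complex.exp (ω (t * z)) - 1) / β := by
    intro z hz t ht
    have h := hω _ (hray z hz t ht)
    simp only at h
    rw [← h]
    field_simp
    ring
  have hωt : ∀ z ∈ ball (0:ℂ) 1, ∀ t ∈ Set.Icc (0:ℝ) 1, ‖ω (t * z)‖ ≤ t * ‖z‖ := by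
    intro z hz t ht
    have := hωn _ (mem_ball_zero_iff.1 (hray z hz t ht))
    rwa [norm_mul, Complex.norm_real, Real.norm_eq_abs, abs_of_nonneg ht.1] at this
  -- norm bound
  have hfn : ∀ z ∈ ball (0:ℂ) 1, ‖f z‖ ≤ 0.777 := by
    intro z hz
    have hB : ∀ t : ℝ, HasDerivAt (fun t : ℝ => (t + t ^ 2 / 4 + t ^ 3 / 18 + t ^ 4 / 72) / β)
        ((1 + t / 2 + t ^ 2 / 6 + t ^ 3 / 18) / β) t := by
      intro t
      have h2 := ((((hasDerivAt_id t).add ((hasDerivAt_pow 2 t).div_const 4)).add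
        ((hasDerivAt_pow 3 t).div_const 18)).add ((hasDerivAt_pow 4 t).div_const 72)).div_const β
      convert! h2 using 1
      norm_num; ring
    have hpos : ∀ t ∈ Set.Ioc (0:ℝ) 1, ‖deriv p (t * z) / p (t * z) * z‖ ≤
        (1 + t / 2 + t ^ 2 / 6 + t ^ 3 / 18) / β := by
      intro t ht
      have ht' : t ∈ Set.Icc (0:ℝ) 1 := ⟨ht.1.le, ht.2⟩
      have h1 := congrArg norm (hode z hz t ht')
      rw [norm_mul, norm_div, Complex.norm_real, Complex.norm_real, Real.norm_eq_abs,
        Real.norm_eq_abs, abs_of_pos ht.1, abs_of_pos hβ0] at h1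
      have h2 := aux_norm_exp_sub_one (ω (t * z)) t
        ((hωt z hz t ht').trans (by nlinarith [mem_ball_zero_iff.1 hz, ht.1])) ht.2
      have h3 : t * ‖deriv p (t * z) / p (t * z) * z‖ ≤
          t * ((1 + t / 2 + t ^ 2 / 6 + t ^ 3 / 18) / β) := by
        rw [h1, ← mul_div_assoc]
        gcongr
      exact le_of_mul_le_mul_left h3 ht.1
    have hcont : ContinuousOn (fun t : ℝ => deriv p (t * z) / p (t * z) * z) (Set.Icc 0 1) := by
      refine ContinuousOn.mul ?_ continuousOn_const
      exact hlog.continuousOn.comp (f := fun t : ℝ => (t * z : ℂ)) (by fun_prop) (hray z hz)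
    have hall : ∀ t ∈ Set.Ico (0:ℝ) 1, ‖deriv p (t * z) / p (t * z) * z‖ ≤
        (1 + t / 2 + t ^ 2 / 6 + t ^ 3 / 18) / β := by
      intro t ht
      rcases ht.1.eq_or_lt with h | h
      · have hc : Set.Icc (0:ℝ) 1 ⊆ closure (Set.Ioc 0 1) := by
          rw [closure_Ioc (by norm_num)]
        refine ContinuousWithinAt.closure_le (s := Set.Ioc (0:ℝ) 1) (hc ⟨ht.1, ht.2.le⟩)
          ((hcont.norm t ⟨ht.1, ht.2.le⟩).mono Set.Ioc_subset_Icc_self)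
          (Continuous.continuousWithinAt (by fun_prop)) hpos
      · exact hpos t ⟨h, ht.2.le⟩
    have := image_norm_le_of_norm_deriv_right_le_deriv_boundary (a := 0) (b := 1)
      (fun t ht => (hrd z hz t ht).continuousAt.continuousWithinAt)
      (fun t ht => (hrd z hz t ⟨ht.1, ht.2.le⟩).hasDerivWithinAt) (by simp [hf0]) hB hall
      (Set.right_mem_Icc.2 zero_le_one)
    simp only [Complex.ofReal_one, one_mul] at this
    refine this.trans ?_
    rw [div_le_iff₀ hβ0]
    norm_num at hβ1 ⊢; linarith
  -- lower bound for the real part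
  have hfr : ∀ z ∈ ball (0:ℂ) 1, -γ < (f z).re := by
    intro z hz
    have hz1 := mem_ball_zero_iff.1 hz
    have hd : ∀ t ∈ Set.Icc (0:ℝ) 1, HasDerivAt (fun t : ℝ => (f (t * z)).re + auxS (t * ‖z‖) / β)
        ((deriv p (t * z) / p (t * z) * z).re + auxS' (t * ‖z‖) * ‖z‖ / β) t := by
      intro t ht
      have h1 : HasDerivAt (fun t : ℝ => (f (t * z)).re) (deriv p (t * z) / p (t * z) * z).re t :=
        (Complex.reCLM.hasFDerivAt.comp_hasDerivAt t (hrd z hz t ht))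
      have h2 : HasDerivAt (fun t : ℝ => t * ‖z‖) ‖z‖ t := by
        simpa using (hasDerivAt_id t).mul_const ‖z‖
      have h3 := (auxS_hasDeriv (t * ‖z‖) (by
        rw [abs_of_nonneg (mul_nonneg ht.1 (norm_nonneg _))]
        nlinarith [ht.1, ht.2, norm_nonneg z])).comp t h2
      exact h1.add (h3.div_const β)
    have hm : MonotoneOn (fun t : ℝ => (f (t * z)).re + auxS (t * ‖z‖) / β) (Set.Icc 0 1) := by
      refine monotoneOn_of_deriv_nonneg (convex_Icc 0 1)
        (fun t ht => (hd t ht).continuousAt.continuousWithinAt)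
        (fun t ht => (hd t (interior_subset ht)).differentiableAt.differentiableWithinAt) ?_
      intro t ht
      have ht' := interior_subset ht
      rw [(hd t ht').deriv]
      rw [interior_Icc] at ht
      refine nonneg_of_mul_nonneg_right (a := t) ?_ ht.1
      have h1 := congrArg Complex.re (hode z hz t ht')
      rw [Complex.re_ofReal_mul, Complex.div_ofReal_re, Complex.sub_re, Complex.one_re] at h1
      have h2 := auxS'_mul (t * ‖z‖)
      have h3 := aux_re_exp (ω (t * z)) (t * ‖z‖) (hωt z hz t ht')
        (by nlinarith [ht.1, ht.2, norm_nonneg z])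
      have h4 : t * ((deriv p (t * z) / p (t * z) * z).re + auxS' (t * ‖z‖) * ‖z‖ / β) =
          ((Complex.exp (ω (t * z))).re - Real.exp (-(t * ‖z‖))) / β := by
        rw [mul_add, h1]
        field_simp
        linear_combination h2
      rw [h4]
      exact div_nonneg (by linarith) hβ0.le
    have h5 := hm (Set.left_mem_Icc.2 zero_le_one) (Set.right_mem_Icc.2 zero_le_one) zero_le_one
    simp [hf0, auxS_zero] at h5
    have h6 : auxS ‖z‖ < auxS 1 := auxS_strictMono ⟨norm_nonneg _, hz1.le⟩ (by simp) hz1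
    have h7 : auxS ‖z‖ / β < γ := by
      rw [div_lt_iff₀ hβ0]; linarith
    linarith
  -- conclusion
  refine aux_subord p hpd hp0 ?_
  intro z hz ζ hζ heq
  have hn := hfn z hz
  have hr := hfr z hz
  have he := hpf z hz
  rcases aux_unit ζ hζ (p z) heq with h | h | h
  · rw [he, Complex.norm_exp, ← hγe, Real.exp_le_exp] at h
    linarith
  · rw [he, Complex.exp_re, Complex.exp_im, abs_mul, abs_of_pos (Real.exp_pos _)] at h
    have h1 := le_of_mul_le_mul_left h (Real.exp_pos _)
    have h2 : |(f z).im| ≤ 0.777 := (Complex.abs_im_le_norm _).trans hn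
    have hpi := Real.pi_gt_d2
    have h3 : Real.sin |(f z).im| < Real.cos |(f z).im| := by
      rw [← Real.sin_pi_div_two_sub]
      apply Real.sin_lt_sin_of_lt_of_le_pi_div_two
      · linarith [abs_nonneg (f z).im]
      · linarith [abs_nonneg (f z).im]
      · linarith
    rw [Real.cos_abs] at h3
    have h4 : |Real.sin (f z).im| = Real.sin |(f z).im| := by
      rw [← Real.abs_sin_eq_sin_abs_of_abs_le_pi (by linarith)]
    linarith
  · rw [he] at h
    have h1 : ‖Complex.exp (f z) - 1‖ ≤ Real.exp ‖f z‖ - 1 := by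
      have := Complex.norm_exp_sub_sum_le_exp_norm_sub_sum (f z) 1
      simpa using this
    have h2 : Real.exp ‖f z‖ ≤ Real.exp 0.777 := Real.exp_le_exp.2 hn
    have h3 := Real.exp_bound' (x := 0.777) (by norm_num) (by norm_num) (n := 5) (by norm_num)
    have h4 := (h.trans h1).trans (sub_le_sub_right h2 1)
    norm_num [Finset.sum_range_succ, Nat.factorial] at h3 h4
    linarith
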